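/- arXiv:1605.06455 — 9 statements merged into one kernel-verified Lean document; each statement's English description precedes it below -/
import Mathlib

section
/- Let γ ≠ 0 and Ω > |γ|. Define f : (0,∞) → ℝ by f(s) = (8s + Ω)²(1 − γ²/(4s + Ω)²). Then f is strictly increasing on (0,∞) with derivative f'(s) = 8(8s + Ω)[2(4s + Ω)³ − γ²Ω]/(4s + Ω)³ > 0 for all s > 0, f(s) → Ω² − γ² as s → 0⁺, and f(s) → ∞ as s → ∞; hence f maps (0,∞) bijectively onto (Ω² − γ², ∞). -/
open Filter Set

theorem stmt1 (γ Ω : ℝ) (hγ : γ ≠ 0) (hΩ : |γ| < Ω) :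
    let f : ℝ → ℝ := fun s => (8 * s + Ω) ^ 2 * (1 - γ ^ 2 / (4 * s + Ω) ^ 2)
    StrictMonoOn f (Set.Ioi 0)
    ∧ (∀ s : ℝ, 0 < s →
        HasDerivAt f (8 * (8 * s + Ω) * (2 * (4 * s + Ω) ^ 3 - γ ^ 2 * Ω) / (4 * s + Ω) ^ 3) s
        ∧ 0 < 8 * (8 * s + Ω) * (2 * (4 * s + Ω) ^ 3 - γ ^ 2 * Ω) / (4 * s + Ω) ^ 3)
    ∧ Tendsto f (nhdsWithin 0 (Set.Ioi 0)) (nhds (Ω ^ 2 - γ ^ 2))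
    ∧ Tendsto f atTop atTop
    ∧ Set.BijOn f (Set.Ioi 0) (Set.Ioi (Ω ^ 2 - γ ^ 2)) := by
  intro f
  have hΩ0 : 0 < Ω := lt_of_le_of_lt (abs_nonneg γ) hΩ
  have hsq : γ ^ 2 < Ω ^ 2 := sq_lt_sq' (by linarith [neg_abs_le γ]) (by linarith [le_abs_self γ])
  have hd : ∀ s : ℝ, 0 ≤ s →
      HasDerivAt f (8 * (8 * s + Ω) * (2 * (4 * s + Ω) ^ 3 - γ ^ 2 * Ω) / (4 * s + Ω) ^ 3) s := by
    intro s hs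
    have hq : 4 * s + Ω ≠ 0 := by positivity
    have h1 : HasDerivAt (fun s : ℝ => 8 * s + Ω) 8 s := by
      simpa using ((hasDerivAt_id s).const_mul 8).add_const Ω
    have h2 : HasDerivAt (fun s : ℝ => 4 * s + Ω) 4 s := by
      simpa using ((hasDerivAt_id s).const_mul 4).add_const Ω
    have h3 := (h1.fun_pow 2).fun_mul
      (((hasDerivAt_const s (γ ^ 2)).fun_div (h2.fun_pow 2) (pow_ne_zero 2 hq)).const_sub 1)
    refine h3.congr_deriv ?_
    field_simp
    ring
  have hpos : ∀ s : ℝ, 0 ≤ s →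
      0 < 8 * (8 * s + Ω) * (2 * (4 * s + Ω) ^ 3 - γ ^ 2 * Ω) / (4 * s + Ω) ^ 3 := by
    intro s hs
    have h1 : Ω ^ 3 ≤ (4 * s + Ω) ^ 3 := by gcongr; linarith
    have h2 : γ ^ 2 * Ω < Ω ^ 3 := by nlinarith
    have h3 : 0 < Ω ^ 3 := by positivity
    have h4 : 0 < 2 * (4 * s + Ω) ^ 3 - γ ^ 2 * Ω := by linarith
    positivity
  have hcont : ContinuousOn f (Ici 0) := fun s hs => (hd s hs).continuousAt.continuousWithinAt
  have hmono : StrictMonoOn f (Ici 0) := by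
    refine strictMonoOn_of_deriv_pos (convex_Ici 0) hcont ?_
    intro s hs
    rw [interior_Ici] at hs
    rw [(hd s (le_of_lt hs)).deriv]
    exact hpos s (le_of_lt hs)
  have hf0 : f 0 = Ω ^ 2 - γ ^ 2 := by
    simp only [f]
    field_simp
    ring
  have htop : Tendsto f atTop atTop := by
    refine tendsto_atTop_mono' atTop (f₁ := fun s => s + (-(4 * γ ^ 2))) ?_
      (tendsto_atTop_add_const_right _ _ tendsto_id)
    filter_upwards [eventually_ge_atTop (1 : ℝ)] with s hs
    have hq : 0 < 4 * s + Ω := by positivity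
    have h1 : (8 * s + Ω) ^ 2 / (4 * s + Ω) ^ 2 ≤ 4 := by
      rw [div_le_iff₀ (by positivity)]
      nlinarith [mul_pos hq hΩ0]
    have h2 : f s = (8 * s + Ω) ^ 2 - γ ^ 2 * ((8 * s + Ω) ^ 2 / (4 * s + Ω) ^ 2) := by
      simp only [f]
      ring
    have h3 := mul_le_mul_of_nonneg_left h1 (sq_nonneg γ)
    have h4 : s ≤ (8 * s + Ω) ^ 2 := by nlinarith
    rw [h2]
    linarith
  refine ⟨hmono.mono Ioi_subset_Ici_self, fun s hs => ⟨hd s hs.le, hpos s hs.le⟩, ?_, htop, ?_, ?_, ?_⟩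
  · rw [← hf0]
    exact (hd 0 le_rfl).continuousAt.tendsto.mono_left nhdsWithin_le_nhds
  · intro s hs
    rw [mem_Ioi, ← hf0]
    exact hmono self_mem_Ici (Ioi_subset_Ici_self hs) hs
  · exact (hmono.mono Ioi_subset_Ici_self).injOn
  · intro y hy
    rw [mem_Ioi, ← hf0] at hy
    obtain ⟨M, hM, hM0⟩ := ((htop.eventually_ge_atTop y).and (eventually_ge_atTop 0)).exists
    obtain ⟨x, hx, hxy⟩ := intermediate_value_Icc hM0 (hcont.mono Icc_subset_Ici_self) ⟨hy.le, hM⟩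
    refine ⟨x, lt_of_le_of_ne hx.1 ?_, hxy⟩
    rintro rfl
    exact absurd hxy hy.ne
end

section
/- Let γ ≠ 0 and Ω < |γ|. Set s₊ := (|γ| − Ω)/4 > 0 and define f(s) = (8s + Ω)²(1 − γ²/(4s + Ω)²) for s ≥ s₊ (note 4s + Ω ≥ |γ| > 0 there). Then f is strictly increasing on [s₊, ∞), f(s₊) = 0, and f(s) → ∞ as s → ∞; hence f maps (s₊, ∞) bijectively onto (0, ∞). -/
open Filter Set

theorem stmt2 (γ Ω : ℝ) (hγ : γ ≠ 0) (hΩ : Ω < |γ|) :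
    let sp : ℝ := (|γ| - Ω) / 4
    let f : ℝ → ℝ := fun s => (8 * s + Ω) ^ 2 * (1 - γ ^ 2 / (4 * s + Ω) ^ 2)
    0 < sp
    ∧ (∀ s : ℝ, sp ≤ s → |γ| ≤ 4 * s + Ω)
    ∧ StrictMonoOn f (Set.Ici sp)
    ∧ f sp = 0
    ∧ Tendsto f atTop atTop
    ∧ Set.BijOn f (Set.Ioi sp) (Set.Ioi 0) := by
  intro sp f
  have hg : 0 < |γ| := abs_pos.mpr hγ
  have h1 : 0 < sp := by simp only [sp]; linarith
  have h2 : ∀ s : ℝ, sp ≤ s → |γ| ≤ 4 * s + Ω := by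
    intro s hs; simp only [sp] at hs; linarith
  have h3 : StrictMonoOn f (Set.Ici sp) := by
    intro a ha b hb hab
    have ua := h2 a ha
    have ha0 : 0 < a := lt_of_lt_of_le h1 ha
    have hpa : 0 < 4 * a + Ω := by linarith
    have e1 : (8 * a + Ω) ^ 2 < (8 * b + Ω) ^ 2 :=
      pow_lt_pow_left₀ (by linarith) (by linarith) (by norm_num)
    have e2 : γ ^ 2 / (4 * b + Ω) ^ 2 < γ ^ 2 / (4 * a + Ω) ^ 2 :=
      div_lt_div_of_pos_left (by positivity) (by positivity)
        (pow_lt_pow_left₀ (by linarith) (by linarith) (by norm_num))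
    have e3 : γ ^ 2 / (4 * a + Ω) ^ 2 ≤ 1 := by
      rw [div_le_one (by positivity), ← sq_abs γ]
      exact pow_le_pow_left₀ hg.le ua 2
    have e4 : 0 < (8 * b + Ω) ^ 2 := lt_of_le_of_lt (sq_nonneg _) e1
    simp only [f]
    nlinarith
  have h4 : f sp = 0 := by
    have : 4 * sp + Ω = |γ| := by simp only [sp]; ring
    simp only [f, this, sq_abs]
    rw [div_self (pow_ne_zero 2 hγ)]; ring
  have h5 : Tendsto f atTop atTop := by
    have lin : ∀ c : ℝ, 0 < c → Tendsto (fun s : ℝ => (c * s + Ω) ^ 2) atTop atTop := by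
      intro c hc
      exact (tendsto_pow_atTop (by norm_num)).comp
        (tendsto_atTop_add_const_right _ _ (tendsto_id.const_mul_atTop hc))
    have t : Tendsto (fun s : ℝ => 1 - γ ^ 2 / (4 * s + Ω) ^ 2) atTop (nhds (1 - 0)) :=
      tendsto_const_nhds.sub ((lin 4 (by norm_num)).const_div_atTop _)
    exact (lin 8 (by norm_num)).atTop_mul_pos (by norm_num) t
  refine ⟨h1, h2, h3, h4, h5, ?_, ?_, ?_⟩
  · intro s hs
    have := h3 (mem_Ici.2 le_rfl) (mem_Ici.2 (le_of_lt hs)) hs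
    rw [h4] at this
    exact this
  · exact h3.injOn.mono Ioi_subset_Ici_self
  · intro y hy
    obtain ⟨M, hM, hMs⟩ := ((h5.eventually_ge_atTop y).and (eventually_ge_atTop sp)).exists
    have hc : ContinuousOn f (Icc sp M) := by
      have hd : ∀ s ∈ Icc sp M, (4 * s + Ω) ^ 2 ≠ 0 := by
        intro s hs
        have := h2 s hs.1
        exact pow_ne_zero 2 (by linarith)
      have q : ContinuousOn (fun s : ℝ => γ ^ 2 / (4 * s + Ω) ^ 2) (Icc sp M) :=
        ContinuousOn.div (by fun_prop) (by fun_prop) hd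
      exact ContinuousOn.mul (by fun_prop) (continuousOn_const.sub q)
    have hy0 : 0 < y := hy
    obtain ⟨s, hs, hfs⟩ := intermediate_value_Icc hMs hc ⟨by rw [h4]; exact hy0.le, hM⟩
    refine ⟨s, lt_of_le_of_ne hs.1 ?_, hfs⟩
    intro h
    rw [← h, h4] at hfs
    linarith
end

section
/- Let γ ≠ 0 and Ω < −|γ|. Set s₋ := min{(|Ω| − |γ|)/4, |Ω|/8} > 0 and define f(s) = (8s + Ω)²(1 − γ²/(4s + Ω)²) for s ∈ (0, s₋). Then f is strictly decreasing on (0, s₋), f(s) → Ω² − γ² as s → 0⁺, and f(s) → 0 as s → s₋⁻; hence f maps (0, s₋) bijectively onto (0, Ω² − γ²). -/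
open Filter Set

theorem stmt3 (γ Ω : ℝ) (hγ : γ ≠ 0) (hΩ : Ω < -|γ|) :
    let sm : ℝ := min ((|Ω| - |γ|) / 4) (|Ω| / 8)
    let f : ℝ → ℝ := fun s => (8 * s + Ω) ^ 2 * (1 - γ ^ 2 / (4 * s + Ω) ^ 2)
    0 < sm
    ∧ StrictAntiOn f (Set.Ioo 0 sm)
    ∧ Tendsto f (nhdsWithin 0 (Set.Ioi 0)) (nhds (Ω ^ 2 - γ ^ 2))
    ∧ Tendsto f (nhdsWithin sm (Set.Iio sm)) (nhds 0)
    ∧ Set.BijOn f (Set.Ioo 0 sm) (Set.Ioo 0 (Ω ^ 2 - γ ^ 2)) := by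
  intro sm f
  have hg : 0 < |γ| := abs_pos.mpr hγ
  have hw : |Ω| = -Ω := abs_of_neg (by linarith)
  have h1 : sm ≤ (-Ω - |γ|) / 4 := hw ▸ min_le_left _ _
  have h2 : sm ≤ -Ω / 8 := hw ▸ min_le_right _ _
  have hpos : 0 < sm := by
    apply lt_min <;> rw [hw] <;> linarith
  have hcont : ∀ x ≤ sm, ContinuousAt f x := by
    intro x hx
    have hne : (4 * x + Ω) ^ 2 ≠ 0 := pow_ne_zero 2 (by linarith)
    have : ContinuousAt (fun s : ℝ => γ ^ 2 / (4 * s + Ω) ^ 2) x :=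
      ContinuousAt.div (by fun_prop) (by fun_prop) hne
    exact ContinuousAt.mul (by fun_prop) (continuousAt_const.sub this)
  have hanti : StrictAntiOn f (Icc 0 sm) := by
    intro x hx y hy hxy
    obtain ⟨hy0, hy1⟩ := hy
    have hγ2 : 0 < γ ^ 2 := by positivity
    have hyq : γ ^ 2 ≤ (4 * y + Ω) ^ 2 := by
      rw [← sq_abs γ]; nlinarith
    have hyp : 0 < (4 * y + Ω) ^ 2 := by linarith
    apply mul_lt_mul''
    · nlinarith
    · have : γ ^ 2 / (4 * x + Ω) ^ 2 < γ ^ 2 / (4 * y + Ω) ^ 2 := by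
        apply div_lt_div_of_pos_left hγ2 hyp
        nlinarith
      linarith
    · positivity
    · have := (div_le_one hyp).mpr hyq
      linarith
  have hf0 : f 0 = Ω ^ 2 - γ ^ 2 := by
    have : Ω ≠ 0 := by linarith
    simp only [f, mul_zero, zero_add]
    field_simp
  have hfs : f sm = 0 := by
    rcases min_choice ((|Ω| - |γ|) / 4) (|Ω| / 8) with h | h
    · have h' : 4 * sm + Ω = -|γ| := by
        change sm = _ at h
        rw [h, hw]; ring
      simp only [f]
      rw [h', neg_sq, sq_abs, div_self (by positivity)]
      ring
    · have h' : 8 * sm + Ω = 0 := by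
        change sm = _ at h
        rw [h, hw]; ring
      simp only [f]
      rw [h']
      ring
  have m0 : (0:ℝ) ∈ Icc 0 sm := ⟨le_rfl, hpos.le⟩
  have m1 : sm ∈ Icc 0 sm := ⟨hpos.le, le_rfl⟩
  refine ⟨hpos, hanti.mono Ioo_subset_Icc_self, ?_, ?_, ?_, ?_, ?_⟩
  · rw [← hf0]
    exact (hcont 0 hpos.le).tendsto.mono_left nhdsWithin_le_nhds
  · have := (hcont sm le_rfl).tendsto
    rw [hfs] at this
    exact this.mono_left nhdsWithin_le_nhds
  · intro x hx
    have hx' := Ioo_subset_Icc_self hx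
    rw [← hf0]
    refine ⟨?_, hanti m0 hx' hx.1⟩
    have := hanti hx' m1 hx.2
    rwa [hfs] at this
  · exact (hanti.mono Ioo_subset_Icc_self).injOn
  · have := intermediate_value_Ioo' hpos.le
      (fun x hx => (hcont x hx.2).continuousWithinAt : ContinuousOn f (Icc 0 sm))
    rw [hfs, hf0] at this
    exact this
end

section
/- Let γ ≠ 0 and Ω < −|γ|, and set s₋ := min{(|Ω| − |γ|)/4, |Ω|/8}. Then for every s with 0 < s ≤ s₋ one has 2(Ω + 4s)³ ≤ min{−2|γ|³, −|Ω|³/4} ≤ Ωγ², with equality 2(Ω + 4s)³ = Ωγ² holding if and only if |Ω| = 2|γ| and s = s₋. In particular, if Ω ≠ −2|γ| then 2(Ω + 4s)³ < Ωγ² for all s ∈ (0, s₋]. -/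
theorem stmt6_aux (g w x : ℝ) (hg : 0 < g) (hw : g < w) (h1 : g ≤ x) (h2 : w / 2 ≤ x)
    (he : 2 * x ^ 3 = w * g ^ 2) : w = 2 * g ∧ x = g := by
  have h3 : g ^ 3 ≤ x ^ 3 := pow_le_pow_left₀ hg.le h1 3
  have h4 : (w / 2) ^ 3 ≤ x ^ 3 := pow_le_pow_left₀ (by linarith) h2 3
  have hw0 : 0 < w := by linarith
  have a : 2 * g ≤ w := by
    have : (2 * g) * g ^ 2 ≤ w * g ^ 2 := by nlinarith
    exact le_of_mul_le_mul_right this (by positivity)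
  have b : w ≤ 2 * g := by
    have : w * w ^ 2 ≤ w * (2 * g) ^ 2 := by nlinarith
    exact le_of_sq_le_sq (le_of_mul_le_mul_left this hw0) (by linarith)
  have c : w = 2 * g := le_antisymm b a
  refine ⟨c, ?_⟩
  have : x ^ 3 = g ^ 3 := by rw [c] at he; linarith
  exact (pow_left_inj₀ (by linarith) hg.le (by norm_num)).1 this

theorem stmt6 (γ Ω : ℝ) (hγ : γ ≠ 0) (hΩ : Ω < -|γ|) :
    let sm : ℝ := min ((|Ω| - |γ|) / 4) (|Ω| / 8)
    (∀ s : ℝ, 0 < s → s ≤ sm →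
      2 * (Ω + 4 * s) ^ 3 ≤ min (-2 * |γ| ^ 3) (-|Ω| ^ 3 / 4)
      ∧ min (-2 * |γ| ^ 3) (-|Ω| ^ 3 / 4) ≤ Ω * γ ^ 2
      ∧ (2 * (Ω + 4 * s) ^ 3 = Ω * γ ^ 2 ↔ (|Ω| = 2 * |γ| ∧ s = sm)))
    ∧ (Ω ≠ -2 * |γ| → ∀ s : ℝ, 0 < s → s ≤ sm → 2 * (Ω + 4 * s) ^ 3 < Ω * γ ^ 2) := by
  intro sm
  have hg : 0 < |γ| := abs_pos.2 hγ
  have hO : |Ω| = -Ω := abs_of_neg (by linarith)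
  have hsq : γ ^ 2 = |γ| ^ 2 := (sq_abs γ).symm
  have main : ∀ s : ℝ, 0 < s → s ≤ sm →
      2 * (Ω + 4 * s) ^ 3 ≤ min (-2 * |γ| ^ 3) (-|Ω| ^ 3 / 4)
      ∧ min (-2 * |γ| ^ 3) (-|Ω| ^ 3 / 4) ≤ Ω * γ ^ 2
      ∧ (2 * (Ω + 4 * s) ^ 3 = Ω * γ ^ 2 ↔ (|Ω| = 2 * |γ| ∧ s = sm)) := by
    intro s hs hsm
    obtain ⟨k1, k2⟩ := le_min_iff.1 hsm
    simp only [sm]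
    rw [hsq, hO] at *
    generalize |γ| = g at *
    obtain ⟨w, rfl⟩ : ∃ w, Ω = -w := ⟨-Ω, by ring⟩
    simp only [neg_neg] at *
    obtain ⟨x, hx⟩ : ∃ x, x = w - 4 * s := ⟨_, rfl⟩
    have e : -w + 4 * s = -x := by linarith
    rw [e]
    have h1 : g ≤ x := by linarith
    have h2 : w / 2 ≤ x := by linarith
    have hw : g < w := by linarith
    have h3 : g ^ 3 ≤ x ^ 3 := pow_le_pow_left₀ hg.le h1 3
    have h4 : (w / 2) ^ 3 ≤ x ^ 3 := pow_le_pow_left₀ (by linarith) h2 3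
    refine ⟨le_min (by nlinarith) (by nlinarith), ?_, ?_, ?_⟩
    · rcases le_total w (2 * g) with h | h
      · refine (min_le_left _ _).trans ?_
        nlinarith [mul_le_mul_of_nonneg_right h (sq_nonneg g)]
      · refine (min_le_right _ _).trans ?_
        have : (2 * g) ^ 2 ≤ w ^ 2 := pow_le_pow_left₀ (by linarith) h 2
        nlinarith [mul_le_mul_of_nonneg_left this (by linarith : 0 ≤ w)]
    · intro h
      obtain ⟨a, b⟩ := stmt6_aux g w x hg hw h1 h2 (by nlinarith)
      refine ⟨a, ?_⟩
      rw [min_eq_left (by linarith)]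
      linarith
    · rintro ⟨a, b⟩
      rw [min_eq_left (by linarith)] at b
      have : x = g := by linarith
      rw [this, a]; ring
  refine ⟨main, fun hne s hs hsm => ?_⟩
  obtain ⟨a, b, c⟩ := main s hs hsm
  refine lt_of_le_of_ne (a.trans b) fun h => hne ?_
  have := (c.1 h).1
  linarith
end

section
/- Let ε > 0 and γ, Ω ∈ ℝ, and suppose either Ω > 4ε (case Ω > 0) or Ω < 0; set γ₀ := Ω − 4ε in the first case and γ₀ := |Ω| in the second case. If |γ| < γ₀ then for every k ∈ [−π, π] one has (Ω − 4ε sin²(k/2))² − γ² > 0, so both roots ω of the dispersion relation 4ω² + γ² − (Ω − 4ε sin²(k/2))² = 0 are real and nonzero. If |γ| > γ₀ then there exists k ∈ [−π, π] with (Ω − 4ε sin²(k/2))² − γ² < 0, so the roots ω are purely imaginary and nonzero. -/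
theorem root_parts (γ Ω ε s : ℝ) (ω : ℂ)
    (h : 4 * ω ^ 2 + (γ : ℂ) ^ 2 - ((Ω : ℂ) - 4 * (ε : ℂ) * (s : ℂ) ^ 2) ^ 2 = 0) :
    4 * (ω.re ^ 2 - ω.im ^ 2) = (Ω - 4 * ε * s ^ 2) ^ 2 - γ ^ 2 ∧ ω.re * ω.im = 0 := by
  have h1 : 4 * ω ^ 2 = (((Ω - 4 * ε * s ^ 2) ^ 2 - γ ^ 2 : ℝ) : ℂ) := by
    push_cast
    linear_combination h
  have hω : 4 * ω ^ 2 = ((4 * (ω.re ^ 2 - ω.im ^ 2) : ℝ) : ℂ)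
      + ((8 * (ω.re * ω.im) : ℝ) : ℂ) * Complex.I := by
    conv_lhs => rw [← Complex.re_add_im ω]
    push_cast
    linear_combination 4 * (ω.im : ℂ) ^ 2 * Complex.I_sq
  rw [hω] at h1
  have hr := congrArg Complex.re h1
  have hi := congrArg Complex.im h1
  rw [Complex.add_re, Complex.re_ofReal_mul, Complex.I_re, Complex.ofReal_re,
    Complex.ofReal_re] at hr
  rw [Complex.add_im, Complex.im_ofReal_mul, Complex.I_im, Complex.ofReal_im,
    Complex.ofReal_im] at hi
  constructor <;> linarith

theorem root_real (γ Ω ε s : ℝ) (hD : 0 < (Ω - 4 * ε * s ^ 2) ^ 2 - γ ^ 2) (ω : ℂ)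
    (h : 4 * ω ^ 2 + (γ : ℂ) ^ 2 - ((Ω : ℂ) - 4 * (ε : ℂ) * (s : ℂ) ^ 2) ^ 2 = 0) :
    ω.im = 0 ∧ ω ≠ 0 := by
  obtain ⟨h1, h2⟩ := root_parts γ Ω ε s ω h
  have hre : ω.re ≠ 0 := by
    intro h0
    rw [h0] at h1
    nlinarith [sq_nonneg ω.im]
  refine ⟨(mul_eq_zero.mp h2).resolve_left hre, ?_⟩
  rintro rfl
  exact hre rfl

theorem root_imag (γ Ω ε s : ℝ) (hD : (Ω - 4 * ε * s ^ 2) ^ 2 - γ ^ 2 < 0) (ω : ℂ)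
    (h : 4 * ω ^ 2 + (γ : ℂ) ^ 2 - ((Ω : ℂ) - 4 * (ε : ℂ) * (s : ℂ) ^ 2) ^ 2 = 0) :
    ω.re = 0 ∧ ω ≠ 0 := by
  obtain ⟨h1, h2⟩ := root_parts γ Ω ε s ω h
  have him : ω.im ≠ 0 := by
    intro h0
    rw [h0] at h1
    nlinarith [sq_nonneg ω.re]
  refine ⟨(mul_eq_zero.mp h2).resolve_right him, ?_⟩
  rintro rfl
  exact him rfl

theorem stmt9 (γ Ω ε : ℝ) (hε : 0 < ε) (hcase : 4 * ε < Ω ∨ Ω < 0) :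
    let γ₀ : ℝ := if 0 < Ω then Ω - 4 * ε else |Ω|
    (|γ| < γ₀ → ∀ k ∈ Set.Icc (-Real.pi) Real.pi,
      0 < (Ω - 4 * ε * Real.sin (k / 2) ^ 2) ^ 2 - γ ^ 2
      ∧ ∀ ω : ℂ, 4 * ω ^ 2 + (γ : ℂ) ^ 2 - ((Ω : ℂ) - 4 * (ε : ℂ) * (Real.sin (k / 2) : ℂ) ^ 2) ^ 2 = 0 →
          ω.im = 0 ∧ ω ≠ 0)
    ∧ (γ₀ < |γ| → ∃ k ∈ Set.Icc (-Real.pi) Real.pi,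
      (Ω - 4 * ε * Real.sin (k / 2) ^ 2) ^ 2 - γ ^ 2 < 0
      ∧ ∀ ω : ℂ, 4 * ω ^ 2 + (γ : ℂ) ^ 2 - ((Ω : ℂ) - 4 * (ε : ℂ) * (Real.sin (k / 2) : ℂ) ^ 2) ^ 2 = 0 →
          ω.re = 0 ∧ ω ≠ 0) := by
  intro γ₀
  constructor
  · intro hγ k _
    have hs : Real.sin (k / 2) ^ 2 ≤ 1 := Real.sin_sq_le_one _
    have hs0 : 0 ≤ Real.sin (k / 2) ^ 2 := sq_nonneg _
    have hD : 0 < (Ω - 4 * ε * Real.sin (k / 2) ^ 2) ^ 2 - γ ^ 2 := by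
      have key : |γ| < |Ω - 4 * ε * Real.sin (k / 2) ^ 2| := by
        have e0 : 0 ≤ ε * Real.sin (k / 2) ^ 2 := mul_nonneg hε.le hs0
        have e1 : ε * Real.sin (k / 2) ^ 2 ≤ ε := mul_le_of_le_one_right hε.le hs
        rcases hcase with h | h
        · have hp : 0 < Ω := by linarith
          simp only [γ₀, if_pos hp] at hγ
          exact lt_of_lt_of_le (by linarith) (le_abs_self _)
        · simp only [γ₀, if_neg (not_lt.mpr h.le), abs_of_neg h] at hγ
          exact lt_of_lt_of_le (by linarith) (neg_le_abs _)
      linarith [sq_lt_sq.mpr key]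
    exact ⟨hD, root_real γ Ω ε _ hD⟩
  · intro hγ
    rcases hcase with h | h
    · have hp : 0 < Ω := by linarith
      simp only [γ₀, if_pos hp] at hγ
      have hD : (Ω - 4 * ε * Real.sin (Real.pi / 2) ^ 2) ^ 2 - γ ^ 2 < 0 := by
        rw [Real.sin_pi_div_two]
        have key : |Ω - 4 * ε * 1 ^ 2| < |γ| := by
          rw [abs_of_pos (by linarith)]
          linarith
        linarith [sq_lt_sq.mpr key]
      exact ⟨Real.pi, ⟨by linarith [Real.pi_pos], le_rfl⟩, hD, root_imag γ Ω ε _ hD⟩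
    · simp only [γ₀, if_neg (not_lt.mpr h.le)] at hγ
      have hD : (Ω - 4 * ε * Real.sin (0 / 2) ^ 2) ^ 2 - γ ^ 2 < 0 := by
        have e : Ω - 4 * ε * Real.sin (0 / 2) ^ 2 = Ω := by simp
        rw [e]
        linarith [sq_lt_sq.mpr hγ]
      exact ⟨0, ⟨by linarith [Real.pi_pos], Real.pi_pos.le⟩, hD, root_imag γ Ω ε _ hD⟩
end

section
/- Let γ ≠ 0 and real E, A > 0 satisfy the dimer compatibility condition γ²(8A² + Ω)² + E²(4A² + Ω)² = (4A² + Ω)²(8A² + Ω)², and suppose either (branch a) Ω > |γ| and A² > 0, or (branch b) Ω < |γ| and A² ≥ (|γ| − Ω)/4. Then the three nonzero eigenvalues of the Hermitian 4×4 matrix L₀, namely μ₁ = 2(4A² + Ω) and μ_{2,3} = 12A² + Ω ± √((4A² − Ω)² + 16ΩA²γ²/(4A² + Ω)²), are all strictly positive; i.e., L₀ is positive semidefinite with one-dimensional kernel. -/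
open Complex
open scoped ComplexOrder

theorem aux_main (s a c g : ℝ) (hs : 0 < s) (ha : 0 < a) (hg : g ≠ 0) (hcg : c ^ 2 + g ^ 2 = 1)
    (L : Matrix (Fin 4) (Fin 4) ℂ)
    (hL : L = !![(a : ℂ) + s, a * c, a * c - s * (c + g * I), a;
      a * c, (a : ℂ) + s, a, a * c - s * (c - g * I);
      a * c - s * (c - g * I), a, (a : ℂ) + s, a * c;
      (a : ℂ), a * c - s * (c + g * I), a * c, a + s]) :
    L.PosSemidef ∧ Module.finrank ℂ (LinearMap.ker L.mulVecLin) = 1 := by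
  obtain ⟨u, hu, rfl⟩ : ∃ u : ℝ, 0 < u ∧ s = u ^ 2 :=
    ⟨√s, Real.sqrt_pos.2 hs, (Real.sq_sqrt hs.le).symm⟩
  obtain ⟨v, hv, rfl⟩ : ∃ v : ℝ, 0 < v ∧ a = v ^ 2 :=
    ⟨√a, Real.sqrt_pos.2 ha, (Real.sq_sqrt ha.le).symm⟩
  have hu' : (u : ℂ) ≠ 0 := by exact_mod_cast hu.ne'
  have hv' : (v : ℂ) ≠ 0 := by exact_mod_cast hv.ne'
  have hg' : (g : ℂ) ≠ 0 := by exact_mod_cast hg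
  have hcg' : (c : ℂ) ^ 2 + (g : ℂ) ^ 2 = 1 := by exact_mod_cast hcg
  have hI : I ^ 2 = -1 := I_sq
  let B : Matrix (Fin 4) (Fin 4) ℂ :=
    !![(u : ℂ), 0, -u * (c + g * I), 0;
       0, (u : ℂ), 0, -u * (c - g * I);
       (v : ℂ), v * c, v * c, v;
       0, (v : ℂ) * g, v * g, 0]
  have hB : L = B.conjTranspose * B := by
    rw [hL]
    ext i j
    fin_cases i <;> fin_cases j <;>
      simp [B, Matrix.mul_apply, Fin.sum_univ_four] <;> grind
  rw [hB]
  refine ⟨Matrix.posSemidef_conjTranspose_mul_self B, ?_⟩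
  rw [Matrix.ker_mulVecLin_conjTranspose_mul_self]
  have hk : ∀ x : Fin 4 → ℂ, x ∈ LinearMap.ker B.mulVecLin ↔
      x = x 2 • ![(c : ℂ) + g * I, -1, 1, -(c + g * I)] := by
    intro x
    rw [LinearMap.mem_ker, Matrix.mulVecLin_apply]
    constructor
    · intro h
      have h0 := congrFun h 0
      have h1 := congrFun h 1
      have h2 := congrFun h 2
      have h3 := congrFun h 3
      simp [B, Matrix.mulVec, dotProduct, Fin.sum_univ_four] at h0 h1 h2 h3
      have e3 : x 1 = - x 2 := by
        have : (v * g : ℂ) * (x 1 + x 2) = 0 := by linear_combination h3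
        have := (mul_eq_zero.1 this).resolve_left (mul_ne_zero hv' hg')
        linear_combination this
      have e0 : x 0 = (c + g * I) * x 2 := by
        have : (u : ℂ) * (x 0 - (c + g * I) * x 2) = 0 := by linear_combination h0
        have := (mul_eq_zero.1 this).resolve_left hu'
        linear_combination this
      have e2 : x 3 = - x 0 := by
        have : (v : ℂ) * (x 0 + x 3) = 0 := by linear_combination h2 - v * c * e3
        have := (mul_eq_zero.1 this).resolve_left hv'
        linear_combination this
      ext i
      fin_cases i
      · simp; linear_combination e0
      · simp; linear_combination e3
      · simp
      · simp; linear_combination e2 - e0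
    · intro h
      rw [h]
      ext i
      fin_cases i <;> simp [B, Matrix.mulVec, dotProduct, Fin.sum_univ_four] <;> grind
  refine finrank_eq_one_iff'.2
    ⟨⟨![(c : ℂ) + g * I, -1, 1, -(c + g * I)], (hk _).2 (by simp)⟩, ?_, ?_⟩
  · intro h
    have := congrFun (congrArg Subtype.val h) 2
    simp at this
  · rintro ⟨x, hx⟩
    exact ⟨x 2, Subtype.ext ((hk x).1 hx).symm⟩

theorem stmt12 (γ Ω E A : ℝ) (hγ : γ ≠ 0) (hA : 0 < A)
    (hcomp : γ ^ 2 * (8 * A ^ 2 + Ω) ^ 2 + E ^ 2 * (4 * A ^ 2 + Ω) ^ 2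
      = (4 * A ^ 2 + Ω) ^ 2 * (8 * A ^ 2 + Ω) ^ 2)
    (hbranch : (|γ| < Ω ∧ 0 < A ^ 2) ∨ (Ω < |γ| ∧ (|γ| - Ω) / 4 ≤ A ^ 2)) :
    let c : ℝ := E / (8 * A ^ 2 + Ω)
    let μ₁ : ℝ := 2 * (4 * A ^ 2 + Ω)
    let μ₂ : ℝ := 12 * A ^ 2 + Ω
      + Real.sqrt ((4 * A ^ 2 - Ω) ^ 2 + 16 * Ω * A ^ 2 * γ ^ 2 / (4 * A ^ 2 + Ω) ^ 2)
    let μ₃ : ℝ := 12 * A ^ 2 + Ω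
      - Real.sqrt ((4 * A ^ 2 - Ω) ^ 2 + 16 * Ω * A ^ 2 * γ ^ 2 / (4 * A ^ 2 + Ω) ^ 2)
    let L₀ : Matrix (Fin 4) (Fin 4) ℂ :=
      !![(Ω : ℂ) + 8 * (A : ℂ) ^ 2, 4 * (A : ℂ) ^ 2 * (c : ℂ),
           -(E : ℂ) - (γ : ℂ) * Complex.I + 8 * (A : ℂ) ^ 2 * (c : ℂ), 4 * (A : ℂ) ^ 2;
         4 * (A : ℂ) ^ 2 * (c : ℂ), (Ω : ℂ) + 8 * (A : ℂ) ^ 2,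
           4 * (A : ℂ) ^ 2, -(E : ℂ) + (γ : ℂ) * Complex.I + 8 * (A : ℂ) ^ 2 * (c : ℂ);
         -(E : ℂ) + (γ : ℂ) * Complex.I + 8 * (A : ℂ) ^ 2 * (c : ℂ), 4 * (A : ℂ) ^ 2,
           (Ω : ℂ) + 8 * (A : ℂ) ^ 2, 4 * (A : ℂ) ^ 2 * (c : ℂ);
         4 * (A : ℂ) ^ 2, -(E : ℂ) - (γ : ℂ) * Complex.I + 8 * (A : ℂ) ^ 2 * (c : ℂ),
           4 * (A : ℂ) ^ 2 * (c : ℂ), (Ω : ℂ) + 8 * (A : ℂ) ^ 2]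
    0 < μ₁ ∧ 0 < μ₂ ∧ 0 < μ₃
    ∧ L₀.PosSemidef
    ∧ Module.finrank ℂ (LinearMap.ker L₀.mulVecLin) = 1 := by
  intro c μ₁ μ₂ μ₃ L₀
  have hA2 : 0 < A ^ 2 := by positivity
  have hsγ : |γ| ≤ 4 * A ^ 2 + Ω := by
    rcases hbranch with h | h <;> linarith [h.1, h.2]
  have hs : 0 < 4 * A ^ 2 + Ω := lt_of_lt_of_le (abs_pos.2 hγ) hsγ
  have hp : 0 < 8 * A ^ 2 + Ω := by linarith
  obtain ⟨g, hg⟩ : ∃ g : ℝ, g = γ / (4 * A ^ 2 + Ω) := ⟨_, rfl⟩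
  have hγg : γ = g * (4 * A ^ 2 + Ω) := by rw [hg]; field_simp
  have hEc : E = c * (8 * A ^ 2 + Ω) := by simp only [c]; field_simp
  have hg0 : g ≠ 0 := by rintro rfl; simp at hγg; exact hγ hγg
  have hcg : c ^ 2 + g ^ 2 = 1 := by
    have h0 : (4 * A ^ 2 + Ω) ^ 2 * (8 * A ^ 2 + Ω) ^ 2 ≠ 0 := by positivity
    apply mul_left_cancel₀ h0
    calc _ = (g * (4 * A ^ 2 + Ω)) ^ 2 * (8 * A ^ 2 + Ω) ^ 2
          + (c * (8 * A ^ 2 + Ω)) ^ 2 * (4 * A ^ 2 + Ω) ^ 2 := by ring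
      _ = _ := by rw [← hγg, ← hEc, hcomp]; ring
  have hrad : 16 * Ω * A ^ 2 * γ ^ 2 / (4 * A ^ 2 + Ω) ^ 2 = 16 * Ω * A ^ 2 * g ^ 2 := by
    rw [hg, div_pow, mul_div_assoc]
  have hpos : 0 < 12 * A ^ 2 + Ω := by linarith
  have hg1 : g ^ 2 ≤ 1 := by nlinarith [sq_nonneg c]
  have hΩ : Ω * g ^ 2 < 4 * A ^ 2 + Ω := by
    rcases le_total Ω 0 with h | h
    · nlinarith [mul_nonneg (neg_nonneg.2 h) (sq_nonneg g)]
    · nlinarith [mul_le_mul_of_nonneg_left hg1 h]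
  refine ⟨by simp only [μ₁]; linarith, ?_, ?_, ?_⟩
  · simp only [μ₂]; positivity
  · simp only [μ₃]
    rw [sub_pos, Real.sqrt_lt' hpos, hrad]
    nlinarith [mul_pos hA2 (sub_pos.2 hΩ), mul_pos hA2 hs]
  · apply aux_main (4 * A ^ 2 + Ω) (4 * A ^ 2) c g hs (by positivity) hg0 hcg
    have hγg' : (γ : ℂ) = g * (4 * A ^ 2 + Ω) := by rw [hγg]; push_cast; ring
    have hEc' : (E : ℂ) = c * (8 * A ^ 2 + Ω) := by rw [hEc]; push_cast; ring
    simp only [L₀]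
    rw [hγg', hEc']
    ext i j
    fin_cases i <;> fin_cases j <;> simp <;> ring
end

section
/- Fix real γ ≠ 0, Ω, E and A > 0 with 4A² + Ω ≠ 0, 8A² + Ω ≠ 0 and γ²(8A² + Ω)² + E²(4A² + Ω)² = (4A² + Ω)²(8A² + Ω)², and let c := E/(8A² + Ω). Let L₀ be the 4×4 matrix with rows [Ω + 8A², 4A²c, −E − iγ + 8A²c, 4A²], [4A²c, Ω + 8A², 4A², −E + iγ + 8A²c], [−E + iγ + 8A²c, 4A², Ω + 8A², 4A²c], [4A², −E − iγ + 8A²c, 4A²c, Ω + 8A²], and let S be the 4×4 matrix with rows [0,0,1,0], [0,0,0,−1], [1,0,0,0], [0,−1,0,0]. Then the characteristic polynomial of −iS L₀ equals λ²(λ² − λ₀²), where λ₀² = −4[(4A² + Ω)² − Ωγ²/(4A² + Ω)]; i.e., −iS L₀ has a double zero eigenvalue and the pair of simple eigenvalues ±λ₀ with λ₀ = 2i√((4A² + Ω)² − Ωγ²/(4A² + Ω)). -/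
open Complex Polynomial

theorem aux_det (a O c s l i : ℂ) (hi : i ^ 2 = -1) (h : s ^ 2 = 1 - c ^ 2) :
    (Matrix.scalar (Fin 4) l - (-i) • ((!![0, 0, 1, 0; 0, 0, 0, -1; 1, 0, 0, 0; 0, -1, 0, 0] :
      Matrix (Fin 4) (Fin 4) ℂ) *
      !![O + 8 * a, 4 * a * c, -(c * O) - s * (4 * a + O) * i, 4 * a;
         4 * a * c, O + 8 * a, 4 * a, -(c * O) + s * (4 * a + O) * i;
         -(c * O) + s * (4 * a + O) * i, 4 * a, O + 8 * a, 4 * a * c;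
         4 * a, -(c * O) - s * (4 * a + O) * i, 4 * a * c, O + 8 * a])).det
      = l ^ 2 * (l ^ 2 + 4 * ((4 * a + O) ^ 2 - O * s ^ 2 * (4 * a + O))) := by
  have hi3 : i ^ 3 = -i := by rw [pow_succ, hi]; ring
  have hi4 : i ^ 4 = 1 := by rw [show i ^ 4 = (i ^ 2) ^ 2 by ring, hi]; ring
  have hi5 : i ^ 5 = i := by rw [pow_succ, hi4]; ring
  have hi6 : i ^ 6 = -1 := by rw [show i ^ 6 = (i ^ 2) ^ 3 by ring, hi]; ring
  have hi7 : i ^ 7 = -i := by rw [pow_succ, hi6]; ring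
  have hi8 : i ^ 8 = 1 := by rw [show i ^ 8 = (i ^ 2) ^ 4 by ring, hi]; ring
  have hs3 : s ^ 3 = s * (1 - c ^ 2) := by rw [← h]; ring
  have hs4 : s ^ 4 = (1 - c ^ 2) ^ 2 := by rw [← h]; ring
  simp [Matrix.det_succ_row_zero, Fin.sum_univ_succ, Matrix.submatrix, Fin.succAbove,
    Matrix.mul_apply, Matrix.smul_apply, Matrix.vecHead, Matrix.vecTail, Matrix.diagonal_apply]
  ring_nf
  simp only [hi, hi3, hi4, hi5, hi6, hi7, hi8, h, hs3, hs4]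
  ring_nf

theorem stmt16 (γ Ω E A : ℝ) (hγ : γ ≠ 0) (hA : 0 < A)
    (h4 : 4 * A ^ 2 + Ω ≠ 0) (h8 : 8 * A ^ 2 + Ω ≠ 0)
    (hcomp : γ ^ 2 * (8 * A ^ 2 + Ω) ^ 2 + E ^ 2 * (4 * A ^ 2 + Ω) ^ 2
      = (4 * A ^ 2 + Ω) ^ 2 * (8 * A ^ 2 + Ω) ^ 2) :
    let c : ℝ := E / (8 * A ^ 2 + Ω)
    let L₀ : Matrix (Fin 4) (Fin 4) ℂ :=
      !![(Ω : ℂ) + 8 * (A : ℂ) ^ 2, 4 * (A : ℂ) ^ 2 * (c : ℂ),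
           -(E : ℂ) - (γ : ℂ) * Complex.I + 8 * (A : ℂ) ^ 2 * (c : ℂ), 4 * (A : ℂ) ^ 2;
         4 * (A : ℂ) ^ 2 * (c : ℂ), (Ω : ℂ) + 8 * (A : ℂ) ^ 2,
           4 * (A : ℂ) ^ 2, -(E : ℂ) + (γ : ℂ) * Complex.I + 8 * (A : ℂ) ^ 2 * (c : ℂ);
         -(E : ℂ) + (γ : ℂ) * Complex.I + 8 * (A : ℂ) ^ 2 * (c : ℂ), 4 * (A : ℂ) ^ 2,
           (Ω : ℂ) + 8 * (A : ℂ) ^ 2, 4 * (A : ℂ) ^ 2 * (c : ℂ);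
         4 * (A : ℂ) ^ 2, -(E : ℂ) - (γ : ℂ) * Complex.I + 8 * (A : ℂ) ^ 2 * (c : ℂ),
           4 * (A : ℂ) ^ 2 * (c : ℂ), (Ω : ℂ) + 8 * (A : ℂ) ^ 2]
    let S : Matrix (Fin 4) (Fin 4) ℂ :=
      !![0, 0, 1, 0;
         0, 0, 0, -1;
         1, 0, 0, 0;
         0, -1, 0, 0]
    let lamSq : ℝ := -4 * ((4 * A ^ 2 + Ω) ^ 2 - Ω * γ ^ 2 / (4 * A ^ 2 + Ω))
    ((-Complex.I) • (S * L₀)).charpoly = X ^ 2 * (X ^ 2 - C (lamSq : ℂ)) := by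
  intro c L₀ S lamSq
  have h4' : (4 * (A : ℂ) ^ 2 + Ω) ≠ 0 := by exact_mod_cast h4
  have h8' : (8 * (A : ℂ) ^ 2 + Ω) ≠ 0 := by exact_mod_cast h8
  have hE : (E : ℂ) = c * (8 * (A : ℂ) ^ 2 + Ω) := by
    simp only [c]; push_cast; field_simp
  have hg : (γ : ℂ) = ((γ / (4 * A ^ 2 + Ω) : ℝ) : ℂ) * (4 * (A : ℂ) ^ 2 + Ω) := by
    push_cast; field_simp
  have hcs : (((γ / (4 * A ^ 2 + Ω) : ℝ) : ℂ)) ^ 2 = 1 - (c : ℂ) ^ 2 := by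
    have : (γ / (4 * A ^ 2 + Ω)) ^ 2 = 1 - c ^ 2 := by
      simp only [c]
      rw [eq_sub_iff_add_eq, div_pow, div_pow, div_add_div _ _ (pow_ne_zero 2 h4) (pow_ne_zero 2 h8),
        div_eq_one_iff_eq (mul_ne_zero (pow_ne_zero 2 h4) (pow_ne_zero 2 h8))]
      linarith
    exact_mod_cast this
  have hlam : (lamSq : ℂ) = -4 * ((4 * (A : ℂ) ^ 2 + Ω) ^ 2
      - Ω * ((γ / (4 * A ^ 2 + Ω) : ℝ) : ℂ) ^ 2 * (4 * (A : ℂ) ^ 2 + Ω)) := by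
    simp only [lamSq]; push_cast; field_simp
  apply Polynomial.funext
  intro l
  have key := aux_det ((A : ℂ) ^ 2) Ω c ((γ / (4 * A ^ 2 + Ω) : ℝ) : ℂ) l I I_sq hcs
  rw [Matrix.eval_charpoly]
  simp only [eval_mul, eval_pow, eval_X, eval_sub, eval_C]
  rw [hlam]
  refine Eq.trans ?_ (key.trans (by ring))
  rw [← hg]
  have e1 : -((c : ℂ) * Ω) = -(E : ℂ) + 8 * (A : ℂ) ^ 2 * c := by rw [hE]; ring
  have e2 : -(E : ℂ) - γ * I + 8 * (A : ℂ) ^ 2 * c = -((c : ℂ) * Ω) - γ * I := by rw [e1]; ring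
  have e3 : -(E : ℂ) + γ * I + 8 * (A : ℂ) ^ 2 * c = -((c : ℂ) * Ω) + γ * I := by rw [e1]; ring
  simp only [L₀, S, e2, e3]
end

section
/- Let γ, Ω, E be real with |Ω| > |γ| and set E₀ := √(Ω² − γ²). Let Lₙ be the 4×4 matrix with rows [Ω, 0, −E − iγ, 0], [0, Ω, 0, −E + iγ], [−E + iγ, 0, Ω, 0], [0, −E − iγ, 0, Ω], and let S be the 4×4 matrix with rows [0,0,1,0], [0,0,0,−1], [1,0,0,0], [0,−1,0,0]. Then the characteristic polynomial of −iS Lₙ equals (λ² + (E + E₀)²)(λ² + (E − E₀)²); i.e., the eigenvalues of −iS Lₙ are ±λ₊ and ±λ₋ with λ₊ = i(E + E₀) and λ₋ = i(E − E₀). -/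
open Complex Polynomial

theorem stmt17 (γ Ω E : ℝ) (hΩ : |γ| < |Ω|) :
    let E₀ : ℝ := Real.sqrt (Ω ^ 2 - γ ^ 2)
    let Ln : Matrix (Fin 4) (Fin 4) ℂ :=
      !![(Ω : ℂ), 0, -(E : ℂ) - (γ : ℂ) * Complex.I, 0;
         0, (Ω : ℂ), 0, -(E : ℂ) + (γ : ℂ) * Complex.I;
         -(E : ℂ) + (γ : ℂ) * Complex.I, 0, (Ω : ℂ), 0;
         0, -(E : ℂ) - (γ : ℂ) * Complex.I, 0, (Ω : ℂ)]
    let S : Matrix (Fin 4) (Fin 4) ℂ :=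
      !![0, 0, 1, 0;
         0, 0, 0, -1;
         1, 0, 0, 0;
         0, -1, 0, 0]
    ((-Complex.I) • (S * Ln)).charpoly
      = (X ^ 2 + C (((E + E₀) ^ 2 : ℝ) : ℂ)) * (X ^ 2 + C (((E - E₀) ^ 2 : ℝ) : ℂ)) := by
  intro E₀ Ln S
  have hE : (E₀ : ℂ) ^ 2 = (Ω : ℂ) ^ 2 - (γ : ℂ) ^ 2 := by
    have h : E₀ ^ 2 = Ω ^ 2 - γ ^ 2 :=
      Real.sq_sqrt (sub_nonneg.mpr (sq_lt_sq.mpr hΩ).le)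
    exact_mod_cast h
  clear_value E₀
  have hM : (-Complex.I) • (S * Ln) =
      !![(-Complex.I) * (-E + γ * Complex.I), 0, (-Complex.I) * Ω, 0;
         0, (-Complex.I) * (E + γ * Complex.I), 0, Complex.I * Ω;
         (-Complex.I) * Ω, 0, (-Complex.I) * (-E - γ * Complex.I), 0;
         0, Complex.I * Ω, 0, (-Complex.I) * (E - γ * Complex.I)] := by
    ext i j
    fin_cases i <;> fin_cases j <;>
      simp [S, Ln, Matrix.mul_apply, Fin.sum_univ_four] <;> ring
  rw [hM]
  have hI : (C Complex.I : ℂ[X]) ^ 2 = -1 := by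
    rw [← C_pow, Complex.I_sq]; simp
  have hE' : (C (E₀ : ℂ) : ℂ[X]) ^ 2 = C (Ω : ℂ) ^ 2 - C (γ : ℂ) ^ 2 := by
    rw [← C_pow, hE]; simp
  have hdet : ∀ a b c d p q r s : ℂ,
      (!![a, 0, b, 0; 0, p, 0, q; c, 0, d, 0; 0, r, 0, s] : Matrix (Fin 4) (Fin 4) ℂ).charpoly
        = ((X - C a) * (X - C d) - C b * C c) * ((X - C p) * (X - C s) - C q * C r) := by
    intro a b c d p q r s
    simp [Matrix.charpoly, Matrix.det_succ_row_zero, Fin.sum_univ_succ, Matrix.charmatrix_apply,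
      Fin.succAbove, Matrix.diagonal_apply]
    ring
  rw [hdet]
  push_cast
  simp only [C_mul, C_add, C_sub, C_neg, C_pow]
  generalize (C Complex.I : ℂ[X]) = i at *
  generalize (C (E₀ : ℂ) : ℂ[X]) = e at *
  generalize (C (Ω : ℂ) : ℂ[X]) = w at *
  generalize (C (γ : ℂ) : ℂ[X]) = g at *
  generalize (C (E : ℂ) : ℂ[X]) = t at *
  have h1 : (X - -i * (-t + g * i)) * (X - -i * (-t - g * i)) - -i * w * (-i * w)
      = X ^ 2 - 2 * i * t * X - t ^ 2 + e ^ 2 := by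
    grind
  have h2 : (X - -i * (t + g * i)) * (X - -i * (t - g * i)) - i * w * (i * w)
      = X ^ 2 + 2 * i * t * X - t ^ 2 + e ^ 2 := by
    grind
  rw [h1, h2]
  linear_combination (-4 * t ^ 2 * X ^ 2) * hI
end

section
/- Let γ ≠ 0 be real. (i) The cubic equation 8x³ − 4γ²x² − 102γ⁴x − 49γ⁶ = 0 has exactly one positive real root, namely x = (1 + 5√2)γ²/2; consequently Ω_* := −√((1 + 5√2)/2)·|γ| is the unique Ω < −|γ| with Ω² solving this equation. (ii) The quadratic equation 4(γ² − |γ|Ω) = Ω² − γ² in Ω has exactly one negative root, namely Ω = −5|γ|. -/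
theorem stmt19 (γ : ℝ) (hγ : γ ≠ 0) :
    (∀ x : ℝ, (0 < x ∧ 8 * x ^ 3 - 4 * γ ^ 2 * x ^ 2 - 102 * γ ^ 4 * x - 49 * γ ^ 6 = 0)
      ↔ x = (1 + 5 * Real.sqrt 2) * γ ^ 2 / 2)
    ∧ (∀ Ω : ℝ, (Ω < -|γ|
        ∧ 8 * (Ω ^ 2) ^ 3 - 4 * γ ^ 2 * (Ω ^ 2) ^ 2 - 102 * γ ^ 4 * Ω ^ 2 - 49 * γ ^ 6 = 0)
      ↔ Ω = -(Real.sqrt ((1 + 5 * Real.sqrt 2) / 2) * |γ|))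
    ∧ (∀ Ω : ℝ, (Ω < 0 ∧ 4 * (γ ^ 2 - |γ| * Ω) = Ω ^ 2 - γ ^ 2) ↔ Ω = -5 * |γ|) := by
  have hg : 0 < γ ^ 2 := by positivity
  have ha : 0 < |γ| := abs_pos.mpr hγ
  have hs2 : Real.sqrt 2 ^ 2 = 2 := Real.sq_sqrt (by norm_num)
  have hs1 : 1 < Real.sqrt 2 := by
    rw [Real.lt_sqrt (by norm_num)]; norm_num
  have key : ∀ x : ℝ, (0 < x ∧ 8 * x ^ 3 - 4 * γ ^ 2 * x ^ 2 - 102 * γ ^ 4 * x - 49 * γ ^ 6 = 0)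
      ↔ x = (1 + 5 * Real.sqrt 2) * γ ^ 2 / 2 := by
    intro x
    have hfac : 8 * x ^ 3 - 4 * γ ^ 2 * x ^ 2 - 102 * γ ^ 4 * x - 49 * γ ^ 6
        = 4 * (2 * x + γ ^ 2) * (x + (5 * Real.sqrt 2 - 1) * γ ^ 2 / 2)
          * (x - (1 + 5 * Real.sqrt 2) * γ ^ 2 / 2) := by
      linear_combination (25 * γ ^ 4 * (2 * x + γ ^ 2)) * hs2
    rw [hfac]
    constructor
    · rintro ⟨hx, h⟩
      have h1 : 0 < (5 * Real.sqrt 2 - 1) * γ ^ 2 := mul_pos (by linarith) hg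
      have h2 : 4 * (2 * x + γ ^ 2) * (x + (5 * Real.sqrt 2 - 1) * γ ^ 2 / 2) ≠ 0 := by
        apply ne_of_gt
        apply mul_pos <;> linarith
      have := (mul_eq_zero.mp h).resolve_left h2
      linarith
    · intro h
      refine ⟨?_, by rw [h]; ring⟩
      rw [h]; positivity
  refine ⟨key, ?_, ?_⟩
  · intro Ω
    have hr : Real.sqrt ((1 + 5 * Real.sqrt 2) / 2) ^ 2 = (1 + 5 * Real.sqrt 2) / 2 :=
      Real.sq_sqrt (by positivity)
    have hr1 : 1 < Real.sqrt ((1 + 5 * Real.sqrt 2) / 2) := by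
      rw [Real.lt_sqrt (by norm_num)]; linarith
    have hsq : (Real.sqrt ((1 + 5 * Real.sqrt 2) / 2) * |γ|) ^ 2
        = (1 + 5 * Real.sqrt 2) * γ ^ 2 / 2 := by
      rw [mul_pow, hr, sq_abs]; ring
    constructor
    · rintro ⟨hΩ, h⟩
      have h0 : 0 < -Ω := by linarith
      have h1 := (key (Ω ^ 2)).mp ⟨by nlinarith, h⟩
      have h2 : (-Ω) ^ 2 = (Real.sqrt ((1 + 5 * Real.sqrt 2) / 2) * |γ|) ^ 2 := by
        rw [hsq, ← h1]; ring
      have h3 := (pow_left_inj₀ h0.le (by positivity) two_ne_zero).mp h2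
      linarith
    · intro h
      refine ⟨by rw [h]; nlinarith, ((key (Ω ^ 2)).mpr ?_).2⟩
      rw [h, neg_sq, hsq]
  · intro Ω
    rw [← sq_abs γ]
    constructor
    · rintro ⟨hΩ, h⟩
      have h1 : (Ω + 5 * |γ|) * (Ω - |γ|) = 0 := by linear_combination -h
      have := (mul_eq_zero.mp h1).resolve_right (by linarith)
      linarith
    · intro h
      refine ⟨by linarith, by rw [h]; ring⟩
end
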